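/- arXiv:1504.03502 — 2 statements merged into one kernel-verified Lean document; each statement's English description precedes it below -/
import Mathlib

section
/- Let m ≥ 2 be an integer, n = 2^m, and let C be a binary [n,k] code satisfying the conditions (C1) and (C2) with respect to a positive integer a, and set l = (n/(2a))^2. Then for every u ∈ C with u ∉ RM(1,m), the coset u + RM(1,m) contains exactly l codewords of weight n/2 − a, exactly l codewords of weight n/2 + a, and exactly 2n − 2l codewords of weight n/2. -/
open Finset

/-- The (Hamming) weight of a vector over `ZMod 2`. -/
def wt {ι : Type*} [Fintype ι] (x : ι → ZMod 2) : ℕ :=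
  (Finset.univ.filter fun i => x i ≠ 0).card

/-- The first order Reed–Muller code `RM(1,m)`: coordinates are indexed by the
points of `F_2^m`, and the codewords are the evaluation vectors
`v ↦ a·v + b` for `a ∈ F_2^m`, `b ∈ F_2`. -/
def RM1 (m : ℕ) : Set ((Fin m → ZMod 2) → ZMod 2) :=
  {f | ∃ (a : Fin m → ZMod 2) (b : ZMod 2), f = fun v => (∑ i, a i * v i) + b}

/-- A binary `[2^m, k]` code `C` satisfies conditions (C1) and (C2) with respect to
a positive integer `a` with `0 < a < 2^m/2`:
(C1) the set of weights of codewords of `C` is exactly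
`{0, 2^m/2 - a, 2^m/2, 2^m/2 + a, 2^m}`, and
(C2) `C` contains `RM(1,m)` as a subcode. -/
def SatCond (m k a : ℕ) (C : Submodule (ZMod 2) ((Fin m → ZMod 2) → ZMod 2)) : Prop :=
  Module.finrank (ZMod 2) C = k ∧ 0 < a ∧ a < 2 ^ m / 2 ∧
  {w : ℕ | ∃ x ∈ C, wt x = w} =
    ({0, 2 ^ m / 2 - a, 2 ^ m / 2, 2 ^ m / 2 + a, 2 ^ m} : Set ℕ) ∧
  RM1 m ⊆ (C : Set ((Fin m → ZMod 2) → ZMod 2))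

/-- `Ai C i` is the number `A_i(C)` of codewords of weight `i` in `C`. -/
noncomputable def Ai {ι : Type*} [Fintype ι] (C : Set (ι → ZMod 2)) (i : ℕ) : ℕ :=
  {x ∈ C | wt x = i}.ncard

/-- The minimum (nonzero) weight of a code. -/
noncomputable def dmin {ι : Type*} [Fintype ι] (C : Set (ι → ZMod 2)) : ℕ :=
  sInf {w : ℕ | ∃ x ∈ C, x ≠ 0 ∧ wt x = w}

/-- Two binary codes of the same length are equivalent if one is obtained from
the other by a permutation of the coordinates. -/
def CodeEquiv {ι : Type*} [Fintype ι] (C C' : Set (ι → ZMod 2)) : Prop :=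
  ∃ σ : Equiv.Perm ι, C' = (fun x => x ∘ σ) '' C

/-- The dual code of a binary code. -/
def dualCode {ι : Type*} [Fintype ι] (C : Submodule (ZMod 2) (ι → ZMod 2)) :
    Submodule (ZMod 2) (ι → ZMod 2) where
  carrier := {x | ∀ y ∈ C, ∑ i, x i * y i = 0}
  add_mem' := by
    intro x₁ x₂ h₁ h₂ y hy
    simp only [Set.mem_setOf_eq] at h₁ h₂ ⊢
    simp only [Pi.add_apply, add_mul, Finset.sum_add_distrib, h₁ y hy, h₂ y hy, add_zero]
  zero_mem' := by
    intro y hy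
    simp
  smul_mem' := by
    intro c x hx y hy
    simp only [Set.mem_setOf_eq] at hx ⊢
    simp only [Pi.smul_apply, smul_eq_mul, mul_assoc, ← Finset.mul_sum, hx y hy, mul_zero]

/-- The covering radius `ρ(C) = max_x min_{c ∈ C} wt (x - c)`. -/
noncomputable def covRad {ι : Type*} [Fintype ι] (C : Set (ι → ZMod 2)) : ℕ :=
  sSup {r : ℕ | ∃ x : ι → ZMod 2, r = sInf {w : ℕ | ∃ c ∈ C, w = wt (x - c)}}

/-- A code of length `2^m` satisfying the conditions (C1) and (C2) is maximal if it is
not properly contained in any code of length `2^m` satisfying the conditions. -/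
def MaximalSat (m : ℕ) (C : Submodule (ZMod 2) ((Fin m → ZMod 2) → ZMod 2)) : Prop :=
  (∃ k a, SatCond m k a C) ∧
  ∀ D : Submodule (ZMod 2) ((Fin m → ZMod 2) → ZMod 2),
    (∃ k a, SatCond m k a D) → C ≤ D → D = C

/-- `P` has exactly `N` equivalence classes of codes. -/
def ExactlyNClasses {m : ℕ} (N : ℕ)
    (P : Submodule (ZMod 2) ((Fin m → ZMod 2) → ZMod 2) → Prop) : Prop :=
  ∃ f : Fin N → Submodule (ZMod 2) ((Fin m → ZMod 2) → ZMod 2),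
    (∀ i, P (f i)) ∧
    (∀ i j, i ≠ j →
      ¬ CodeEquiv (↑(f i) : Set ((Fin m → ZMod 2) → ZMod 2)) (↑(f j))) ∧
    ∀ C, P C → ∃ i, CodeEquiv (↑C : Set ((Fin m → ZMod 2) → ZMod 2)) (↑(f i))

/-- A weighing matrix of order `n` and weight `k`. -/
def IsWeighing (n k : ℕ) (W : Matrix (Fin n) (Fin n) ℤ) : Prop :=
  (∀ i j, W i j = 0 ∨ W i j = 1 ∨ W i j = -1) ∧
  W * W.transpose = (k : ℤ) • (1 : Matrix (Fin n) (Fin n) ℤ)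

/-- A Hadamard matrix of order `n`. -/
def IsHadamard (n : ℕ) (H : Matrix (Fin n) (Fin n) ℤ) : Prop :=
  (∀ i j, H i j = 1 ∨ H i j = -1) ∧
  H * H.transpose = (n : ℤ) • (1 : Matrix (Fin n) (Fin n) ℤ)
/-- The sign character of `ZMod 2`. -/
def chi (x : ZMod 2) : ℤ := if x = 0 then 1 else -1

lemma chi_add (x y : ZMod 2) : chi (x + y) = chi x * chi y := by
  revert x y; decide

lemma chi_self (x : ZMod 2) : chi x * chi x = 1 := by
  revert x; decide

lemma chi_sum_wt {m : ℕ} (x : (Fin m → ZMod 2) → ZMod 2) :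
    ∑ v, chi (x v) = 2 ^ m - 2 * (wt x : ℤ) := by
  have h : ∀ v, chi (x v) = 1 - 2 * (if x v ≠ 0 then 1 else 0 : ℤ) := by
    intro v; unfold chi; split_ifs <;> simp_all
  simp only [h]
  rw [Finset.sum_sub_distrib, ← Finset.mul_sum, Finset.sum_boole]
  simp [wt]

lemma chi_orth {m : ℕ} (w : Fin m → ZMod 2) :
    ∑ α : Fin m → ZMod 2, chi (∑ i, α i * w i) = if w = 0 then 2 ^ m else 0 := by
  split_ifs with h
  · subst h; simp [chi]
  · obtain ⟨i, hi⟩ : ∃ i, w i ≠ 0 := by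
      by_contra hc; push Not at hc; exact h (funext hc)
    have hi1 : w i = 1 := by
      generalize w i = y at hi; revert y; decide
    have key := Equiv.sum_comp (Equiv.addRight (Pi.single i (1 : ZMod 2)))
      (fun α : Fin m → ZMod 2 => chi (∑ i, α i * w i))
    have h2 : ∀ α : Fin m → ZMod 2,
        chi (∑ j, (Equiv.addRight (Pi.single i (1 : ZMod 2)) α) j * w j)
          = - chi (∑ j, α j * w j) := by
      intro α
      simp only [Equiv.coe_addRight, Pi.add_apply, add_mul, Finset.sum_add_distrib]
      rw [chi_add]
      have : ∑ j, (Pi.single i (1 : ZMod 2) : Fin m → ZMod 2) j * w j = 1 := by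
        simp [Pi.single_apply, hi1]
      rw [this]
      simp [chi]
    simp only [h2, Finset.sum_neg_distrib] at key
    linarith

/-- The Walsh transform of `u`. -/
def walsh {m : ℕ} (u : (Fin m → ZMod 2) → ZMod 2) (α : Fin m → ZMod 2) : ℤ :=
  ∑ v, chi (u v + ∑ i, α i * v i)

lemma parseval {m : ℕ} (u : (Fin m → ZMod 2) → ZMod 2) :
    ∑ α, walsh u α ^ 2 = (2 ^ m) ^ 2 := by
  have h1 : ∀ α, walsh u α ^ 2 = ∑ v, ∑ w, chi (u v) * chi (u w) *
      chi (∑ i, α i * (v + w) i) := by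
    intro α
    rw [sq, walsh, Finset.sum_mul_sum]
    refine Finset.sum_congr rfl fun v _ => Finset.sum_congr rfl fun w _ => ?_
    simp only [Pi.add_apply, mul_add, Finset.sum_add_distrib, chi_add]
    ring
  simp only [h1]
  rw [Finset.sum_comm]
  have h2 : ∀ v : Fin m → ZMod 2, ∑ α : Fin m → ZMod 2, ∑ w, chi (u v) * chi (u w) *
      chi (∑ i, α i * (v + w) i) = 2 ^ m := by
    intro v
    rw [Finset.sum_comm]
    simp only [← Finset.mul_sum, chi_orth]
    have hz : ∀ w : Fin m → ZMod 2, v + w = 0 ↔ w = v := by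
      intro w
      constructor
      · intro h
        funext i
        have := congrFun h i
        simp only [Pi.add_apply, Pi.zero_apply] at this
        revert this
        generalize v i = x; generalize w i = y
        revert x y; decide
      · rintro rfl
        funext i
        simp only [Pi.add_apply, Pi.zero_apply]
        generalize w i = x
        revert x; decide
    simp [hz, chi_self]
  simp only [h2]
  simp [sq]

/-- The map parametrizing the coset. -/
def cw {m : ℕ} (u : (Fin m → ZMod 2) → ZMod 2) (p : (Fin m → ZMod 2) × ZMod 2) :
    (Fin m → ZMod 2) → ZMod 2 := u + fun v => (∑ i, p.1 i * v i) + p.2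

lemma cw_inj {m : ℕ} (u : (Fin m → ZMod 2) → ZMod 2) : Function.Injective (cw u) := by
  rintro ⟨α, b⟩ ⟨β, c⟩ h
  have h' := add_left_cancel h
  have hb : b = c := by simpa using congrFun h' 0
  subst hb
  refine Prod.ext ?_ rfl
  funext i
  simpa [Pi.single_apply] using congrFun h' (Pi.single i 1)

lemma cw_wt {m : ℕ} (u : (Fin m → ZMod 2) → ZMod 2) (p : (Fin m → ZMod 2) × ZMod 2) :
    chi p.2 * walsh u p.1 = 2 ^ m - 2 * (wt (cw u p) : ℤ) := by
  rw [← chi_sum_wt, walsh, Finset.mul_sum]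
  refine Finset.sum_congr rfl fun v _ => ?_
  simp only [cw, Pi.add_apply, chi_add]
  ring

lemma count {m : ℕ} (u : (Fin m → ZMod 2) → ZMod 2) (w : ℕ) :
    ({x | (∃ r ∈ RM1 m, x = u + r) ∧ wt x = w}.ncard : ℤ) =
      ∑ α, ((if walsh u α = 2 ^ m - 2 * w then 1 else 0) +
        (if - walsh u α = 2 ^ m - 2 * w then 1 else 0)) := by
  have h1 : {x | (∃ r ∈ RM1 m, x = u + r) ∧ wt x = w} =
      cw u '' (↑(Finset.univ.filter fun p : (Fin m → ZMod 2) × ZMod 2 =>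
        chi p.2 * walsh u p.1 = 2 ^ m - 2 * w) : Set _) := by
    ext x
    simp only [Set.mem_setOf_eq, Set.mem_image, Finset.coe_filter, Finset.mem_univ, true_and]
    constructor
    · rintro ⟨⟨r, ⟨α, b, rfl⟩, rfl⟩, hw⟩
      refine ⟨(α, b), ?_, rfl⟩
      rw [cw_wt, cw, hw]
    · rintro ⟨p, hp, rfl⟩
      refine ⟨⟨_, ⟨p.1, p.2, rfl⟩, rfl⟩, ?_⟩
      rw [cw_wt] at hp
      omega
  rw [h1, Set.ncard_image_of_injective _ (cw_inj u), Set.ncard_coe_finset,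
    Finset.card_filter, Fintype.sum_prod_type]
  push_cast
  refine Finset.sum_congr rfl fun α _ => ?_
  have h01 : (Finset.univ : Finset (ZMod 2)) = {0, 1} := by decide
  rw [h01, Finset.sum_pair (by decide)]
  simp [chi]

/-- for `u ∈ C` with `u ∉ RM(1,m)`, the coset `u + RM(1,m)` contains
exactly `l` codewords of weight `n/2 - a`, exactly `l` of weight `n/2 + a`, and
exactly `2n - 2l` of weight `n/2`, where `l = (n/(2a))^2`. -/
theorem stmt4 (m k a : ℕ) (hm : 2 ≤ m)
    (C : Submodule (ZMod 2) ((Fin m → ZMod 2) → ZMod 2))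
    (hC : SatCond m k a C)
    (l : ℕ) (hl : l = (2 ^ m / (2 * a)) ^ 2)
    (u : (Fin m → ZMod 2) → ZMod 2) (hu : u ∈ C) (hu' : u ∉ RM1 m) :
    {x | (∃ r ∈ RM1 m, x = u + r) ∧ wt x = 2 ^ m / 2 - a}.ncard = l ∧
    {x | (∃ r ∈ RM1 m, x = u + r) ∧ wt x = 2 ^ m / 2 + a}.ncard = l ∧
    ({x | (∃ r ∈ RM1 m, x = u + r) ∧ wt x = 2 ^ m / 2}.ncard : ℤ) =
      2 * 2 ^ m - 2 * l := by
  obtain ⟨-, ha, ha2, hW, hRM⟩ := hC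
  have h2 : 2 * (2 ^ m / 2) = 2 ^ m := by
    apply Nat.mul_div_cancel'
    exact dvd_pow_self 2 (by omega)
  set h := 2 ^ m / 2 with hh
  have h2z : (2 ^ m : ℤ) = 2 * h := by exact_mod_cast h2.symm
  have hS : ∀ α, walsh u α = 0 ∨ walsh u α = 2 * a ∨ walsh u α = - (2 * a) := by
    intro α
    have hmem : cw u (α, 0) ∈ C := C.add_mem hu (hRM ⟨α, 0, rfl⟩)
    have hw : wt (cw u (α, 0)) ∈ {w : ℕ | ∃ x ∈ C, wt x = w} := ⟨_, hmem, rfl⟩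
    rw [hW] at hw
    have e := cw_wt u (α, 0)
    have hc : chi 0 = 1 := rfl
    simp only [hc, one_mul] at e
    have hu2 : ∀ b : ZMod 2, ¬ (∀ v, cw u (α, 0) v = b) := by
      intro b hb
      apply hu'
      refine ⟨α, b, ?_⟩
      funext v
      have := hb v
      simp only [cw, Pi.add_apply, add_zero] at this
      revert this
      generalize u v = x
      generalize ∑ i, α i * v i = y
      clear hb; revert x y b; decide
    simp only [Set.mem_insert_iff, Set.mem_singleton_iff] at hw
    rcases hw with hw | hw | hw | hw | hw
    · exfalso
      apply hu2 0
      unfold wt at hw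
      rw [Finset.card_eq_zero, Finset.filter_eq_empty_iff] at hw
      intro v
      simpa using hw (Finset.mem_univ v)
    · right; left; omega
    · left; omega
    · right; right; omega
    · exfalso
      apply hu2 1
      have : wt (cw u (α, 0)) = (Finset.univ : Finset (Fin m → ZMod 2)).card := by
        rw [hw]; simp
      unfold wt at this
      rw [Finset.card_filter_eq_iff] at this
      intro v
      have h3 := this v (Finset.mem_univ v)
      revert h3
      generalize cw u (α, 0) v = x
      revert x; decide
  have haz : (0 : ℤ) < a := by exact_mod_cast ha
  have hP := parseval u
  have key1 : (2 * a : ℤ) ^ 2 *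
      ({x | (∃ r ∈ RM1 m, x = u + r) ∧ wt x = h - a}.ncard : ℤ) = (2 ^ m) ^ 2 := by
    rw [count, ← hP, Finset.mul_sum]
    refine Finset.sum_congr rfl fun α _ => ?_
    have e : (2 ^ m - 2 * ((h - a : ℕ) : ℤ)) = 2 * a := by omega
    rw [e]
    rcases hS α with h0 | h0 | h0 <;> rw [h0]
    · rw [if_neg (by omega), if_neg (by omega)]; ring
    · rw [if_pos (by omega), if_neg (by omega)]; ring
    · rw [if_neg (by omega), if_pos (by omega)]; ring
  have key2 : (2 * a : ℤ) ^ 2 *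
      ({x | (∃ r ∈ RM1 m, x = u + r) ∧ wt x = h + a}.ncard : ℤ) = (2 ^ m) ^ 2 := by
    rw [count, ← hP, Finset.mul_sum]
    refine Finset.sum_congr rfl fun α _ => ?_
    have e : (2 ^ m - 2 * ((h + a : ℕ) : ℤ)) = - (2 * a) := by omega
    rw [e]
    rcases hS α with h0 | h0 | h0 <;> rw [h0]
    · rw [if_neg (by omega), if_neg (by omega)]; ring
    · rw [if_neg (by omega), if_pos (by omega)]; ring
    · rw [if_pos (by omega), if_neg (by omega)]; ring
  have key3 : (2 * a : ℤ) ^ 2 *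
      ({x | (∃ r ∈ RM1 m, x = u + r) ∧ wt x = h}.ncard : ℤ) =
      (2 * a) ^ 2 * (2 * 2 ^ m) - 2 * (2 ^ m) ^ 2 := by
    have hcard : ∑ _α : Fin m → ZMod 2, (2 * (2 * a) ^ 2 : ℤ) = (2 * a) ^ 2 * (2 * 2 ^ m) := by
      simp; ring
    rw [count, ← hP, Finset.mul_sum, ← hcard, Finset.mul_sum, ← Finset.sum_sub_distrib]
    refine Finset.sum_congr rfl fun α _ => ?_
    have e : (2 ^ m - 2 * (h : ℤ)) = 0 := by omega
    rw [e]
    rcases hS α with h0 | h0 | h0 <;> rw [h0]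
    · rw [if_pos (by omega), if_pos (by omega)]; ring
    · rw [if_neg (by omega), if_neg (by omega)]; ring
    · rw [if_neg (by omega), if_neg (by omega)]; ring
  have hdvd : 2 * a ∣ 2 ^ m := by
    rw [← Nat.pow_dvd_pow_iff (n := 2) (by norm_num)]
    exact ⟨_, by exact_mod_cast key1.symm⟩
  have hlz : (2 * a : ℤ) ^ 2 * l = (2 ^ m) ^ 2 := by
    have : (2 * a) ^ 2 * l = (2 ^ m) ^ 2 := by
      rw [hl, ← mul_pow, Nat.mul_div_cancel' hdvd]
    exact_mod_cast this
  have hne : (2 * a : ℤ) ^ 2 ≠ 0 := by positivity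
  refine ⟨?_, ?_, ?_⟩
  · have := mul_left_cancel₀ hne (key1.trans hlz.symm)
    exact_mod_cast this
  · have := mul_left_cancel₀ hne (key2.trans hlz.symm)
    exact_mod_cast this
  · apply mul_left_cancel₀ hne
    rw [key3, ← hlz]; ring
end

section
/- There exists a binary [8,6] code satisfying the conditions (C1) and (C2) (with m = 3, n = 8), and any two binary [8,6] codes satisfying the conditions (C1) and (C2) are equivalent. Moreover, for any such code C, the set of weights of codewords of C is exactly {0, 2, 4, 6, 8} (i.e., a = 2). -/
open Finset

/-- functional given by pairing with s -/
noncomputable def pairing (s : (Fin 3 → ZMod 2) → ZMod 2) :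
    ((Fin 3 → ZMod 2) → ZMod 2) →ₗ[ZMod 2] ZMod 2 where
  toFun x := ∑ v, s v * x v
  map_add' x y := by simp [mul_add, Finset.sum_add_distrib]
  map_smul' c x := by
    simp only [Pi.smul_apply, smul_eq_mul, RingHom.id_apply, Finset.mul_sum]
    exact Finset.sum_congr rfl fun i _ => by ring

lemma pairing_apply (s x : (Fin 3 → ZMod 2) → ZMod 2) : pairing s x = ∑ v, s v * x v := rfl

lemma pairing_single (s : (Fin 3 → ZMod 2) → ZMod 2) (u : Fin 3 → ZMod 2) :
    pairing s (Pi.single u 1) = s u := by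
  simp [pairing_apply, Pi.single_apply]

noncomputable def codeD (s : (Fin 3 → ZMod 2) → ZMod 2) :
    Submodule (ZMod 2) ((Fin 3 → ZMod 2) → ZMod 2) :=
  LinearMap.ker ((pairing 1).prod (pairing s))

lemma mem_codeD (s x : (Fin 3 → ZMod 2) → ZMod 2) :
    x ∈ codeD s ↔ (∑ v, x v = 0) ∧ ∑ v, s v * x v = 0 := by
  simp [codeD, pairing_apply]

lemma z2 (c : ZMod 2) : c = 0 ∨ c = 1 := by revert c; decide

lemma finrank_codeD (s : (Fin 3 → ZMod 2) → ZMod 2) (h0 : s ≠ 0) (h1 : s ≠ 1) :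
    Module.finrank (ZMod 2) (codeD s) = 6 := by
  obtain ⟨u, hu⟩ := Function.ne_iff.1 h0
  obtain ⟨w, hw⟩ := Function.ne_iff.1 h1
  have hu' : s u = 1 := (z2 (s u)).resolve_left hu
  have hw' : s w = 0 := (z2 (s w)).resolve_right hw
  have hs : LinearMap.range ((pairing 1).prod (pairing s)) = ⊤ := by
    rw [LinearMap.range_eq_top]
    rintro ⟨p, q⟩
    refine ⟨q • Pi.single u 1 + (p - q) • Pi.single w 1, ?_⟩
    have e1 := pairing_single 1 u
    have e2 := pairing_single 1 w
    have e3 := pairing_single s u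
    have e4 := pairing_single s w
    rw [hu'] at e3
    rw [hw'] at e4
    refine Prod.ext ?_ ?_
    · change pairing 1 _ = p
      rw [map_add, map_smul, map_smul, e1, e2]
      simp
    · change pairing s _ = q
      rw [map_add, map_smul, map_smul, e3, e4]
      simp
  have h := LinearMap.finrank_range_add_finrank_ker ((pairing 1).prod (pairing s))
  rw [hs] at h
  have hc : Fintype.card (Fin 3 → ZMod 2) = 8 := by decide
  simp only [finrank_top, Module.finrank_prod, Module.finrank_self, Module.finrank_fintype_fun_eq_card, hc] at h
  unfold codeD
  omega

lemma sum_eq_wt (x : (Fin 3 → ZMod 2) → ZMod 2) : ∑ v, x v = (wt x : ZMod 2) := by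
  unfold wt
  rw [Finset.card_eq_sum_ones, Finset.sum_filter]
  push_cast
  refine Finset.sum_congr rfl fun v _ => ?_
  rcases z2 (x v) with h | h <;> simp [h]

lemma wt_two (u v : Fin 3 → ZMod 2) (h : u ≠ v) :
    wt (Pi.single u 1 - Pi.single v 1 : (Fin 3 → ZMod 2) → ZMod 2) = 2 := by
  unfold wt
  refine Eq.trans (congrArg Finset.card ?_) (Finset.card_pair h)
  ext w
  simp only [Finset.mem_filter, Finset.mem_univ, true_and, Pi.sub_apply, Pi.single_apply,
    Finset.mem_insert, Finset.mem_singleton]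
  by_cases h1 : w = u
  · have : w ≠ v := fun h2 => h (h1 ▸ h2)
    simp [h1, h]
  · by_cases h2 : w = v <;> simp [h1, h2, Ne.symm h]

lemma a_eq_two {C : Submodule (ZMod 2) ((Fin 3 → ZMod 2) → ZMod 2)} {a : ℕ}
    (h : SatCond 3 6 a C) : a = 2 := by
  obtain ⟨hr, ha0, ha, hw, -⟩ := h
  have hc : Fintype.card (Fin 3 → ZMod 2) = 8 := by decide
  have hq : Module.finrank (ZMod 2) (((Fin 3 → ZMod 2) → ZMod 2) ⧸ C) = 2 := by
    have := C.finrank_quotient_add_finrank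
    rw [Module.finrank_fintype_fun_eq_card, hc, hr] at this
    omega
  have hcard : Nat.card (((Fin 3 → ZMod 2) → ZMod 2) ⧸ C) = 4 := by
    rw [Module.natCard_eq_pow_finrank (K := ZMod 2), hq]; simp
  have : ∃ u v : Fin 3 → ZMod 2, u ≠ v ∧
      C.mkQ (Pi.single u 1) = C.mkQ (Pi.single v 1) := by
    by_contra hcon
    have hinj : Function.Injective
        (fun u : Fin 3 → ZMod 2 => C.mkQ (Pi.single u 1)) := by
      intro u v huv
      by_contra hne
      exact hcon ⟨u, v, hne, huv⟩
    have := Nat.card_le_card_of_injective _ hinj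
    rw [hcard, Nat.card_eq_fintype_card, hc] at this
    omega
  obtain ⟨u, v, hne, huv⟩ := this
  have hm : (Pi.single u 1 - Pi.single v 1 : (Fin 3 → ZMod 2) → ZMod 2) ∈ C :=
    (Submodule.Quotient.eq C).1 huv
  have h2 : 2 ∈ {w : ℕ | ∃ x ∈ C, wt x = w} := ⟨_, hm, wt_two u v hne⟩
  rw [hw] at h2
  simp only [Set.mem_insert_iff, Set.mem_singleton_iff] at h2
  norm_num at h2 ha
  omega

lemma weights {C : Submodule (ZMod 2) ((Fin 3 → ZMod 2) → ZMod 2)} {a : ℕ}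
    (h : SatCond 3 6 a C) : {w : ℕ | ∃ x ∈ C, wt x = w} = ({0, 2, 4, 6, 8} : Set ℕ) := by
  obtain rfl := a_eq_two h
  simpa using h.2.2.2.1

lemma univ_cube : (Finset.univ : Finset (Fin 3 → ZMod 2)) =
    {![0,0,0], ![0,0,1], ![0,1,0], ![0,1,1], ![1,0,0], ![1,0,1], ![1,1,0], ![1,1,1]} := by
  decide

lemma sum_cube {M : Type*} [AddCommMonoid M] (f : (Fin 3 → ZMod 2) → M) :
    ∑ v, f v = f ![0,0,0] + (f ![0,0,1] + (f ![0,1,0] + (f ![0,1,1] + (f ![1,0,0] +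
      (f ![1,0,1] + (f ![1,1,0] + f ![1,1,1])))))) := by
  rw [univ_cube]
  repeat rw [Finset.sum_insert (by decide)]
  rw [Finset.sum_singleton]

set_option synthInstance.maxHeartbeats 400000 in
set_option synthInstance.maxSize 4000 in
set_option maxRecDepth 100000 in
lemma key8 : ∀ a b c d e f g h : ZMod 2,
    a + (b + (c + (d + (e + (f + (g + h)))))) = 0 → b + d + f + h = 0 → c + d + g + h = 0 →
    e + f + g + h = 0 →
    (a = 0 ∧ b = 0 ∧ c = 0 ∧ d = 0 ∧ e = 0 ∧ f = 0 ∧ g = 0 ∧ h = 0) ∨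
    (a = 1 ∧ b = 1 ∧ c = 1 ∧ d = 1 ∧ e = 1 ∧ f = 1 ∧ g = 1 ∧ h = 1) ∨
    (a.val + (b.val + (c.val + (d.val + (e.val + (f.val + (g.val + h.val)))))) = 4) := by
  decide

lemma wt_val (x : (Fin 3 → ZMod 2) → ZMod 2) : wt x = ∑ v, (x v).val := by
  unfold wt
  rw [Finset.card_eq_sum_ones, Finset.sum_filter]
  refine Finset.sum_congr rfl fun v _ => ?_
  generalize x v = c
  revert c; decide

lemma forall_cube (P : (Fin 3 → ZMod 2) → Prop) (h : P ![0,0,0] ∧ P ![0,0,1] ∧ P ![0,1,0] ∧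
    P ![0,1,1] ∧ P ![1,0,0] ∧ P ![1,0,1] ∧ P ![1,1,0] ∧ P ![1,1,1]) (v) : P v := by
  have hv := Finset.mem_univ v
  rw [univ_cube] at hv
  simp only [Finset.mem_insert, Finset.mem_singleton] at hv
  obtain ⟨h1, h2, h3, h4, h5, h6, h7, h8⟩ := h
  rcases hv with h | h | h | h | h | h | h | h <;> rw [h] <;> assumption

lemma wt_four (s : (Fin 3 → ZMod 2) → ZMod 2) (h0 : s ≠ 0) (h1 : s ≠ 1)
    (hs : ∑ v, s v = 0) (hi : ∀ i, ∑ v, s v * v i = 0) : wt s = 4 := by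
  have i0 := hi 0
  have i1 := hi 1
  have i2 := hi 2
  rw [sum_cube] at hs i0 i1 i2
  simp only [Matrix.cons_val, mul_zero, mul_one, zero_add, add_zero] at i0 i1 i2
  rw [wt_val, sum_cube]
  rcases key8 _ _ _ _ _ _ _ _ hs (by simpa [add_assoc] using i2)
    (by simpa [add_assoc] using i1) (by simpa [add_assoc] using i0) with h | h | h
  · exact absurd (funext (forall_cube (fun v => s v = 0) h)) h0
  · exact absurd (funext (forall_cube (fun v => s v = 1) h)) h1
  · exact h

lemma classify_code {C : Submodule (ZMod 2) ((Fin 3 → ZMod 2) → ZMod 2)} {a : ℕ}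
    (h : SatCond 3 6 a C) : ∃ s, wt s = 4 ∧ C = codeD s := by
  have hw := weights h
  obtain ⟨hr, -, -, -, hRM⟩ := h
  have heven : ∀ x ∈ C, ∑ v, x v = 0 := by
    intro x hx
    have : wt x ∈ {w : ℕ | ∃ x ∈ C, wt x = w} := ⟨x, hx, rfl⟩
    rw [hw] at this
    rw [sum_eq_wt]
    simp only [Set.mem_insert_iff, Set.mem_singleton_iff] at this
    rcases this with h | h | h | h | h <;> rw [h] <;> decide
  have hE : ∃ x ∈ LinearMap.ker (pairing 1), x ∉ C := by
    by_contra hcon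
    have hle : LinearMap.ker (pairing 1) ≤ C := by
      intro x hx
      by_contra hn
      exact hcon ⟨x, hx, hn⟩
    have h1 := Submodule.finrank_mono hle
    have h2 := LinearMap.finrank_range_add_finrank_ker (pairing 1)
    have h3 := (LinearMap.range (pairing 1)).finrank_le
    have hc : Fintype.card (Fin 3 → ZMod 2) = 8 := by decide
    rw [Module.finrank_fintype_fun_eq_card, hc] at h2
    rw [Module.finrank_self] at h3
    omega
  obtain ⟨x, hxE, hxC⟩ := hE
  obtain ⟨f, hfx, hf⟩ := Submodule.exists_le_ker_of_notMem hxC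
  let s : (Fin 3 → ZMod 2) → ZMod 2 := fun v => f (Pi.single v 1)
  have hfs : f = pairing s := by
    refine LinearMap.pi_ext' fun v => LinearMap.ext_ring ?_
    simp [pairing_single, s]
  rw [hfs] at hf hfx
  have h0 : s ≠ 0 := by
    intro h; apply hfx; simp [pairing_apply, h]
  have h1 : s ≠ 1 := by
    intro h; apply hfx; rw [h]; exact hxE
  have hCD : C ≤ codeD s := by
    intro y hy
    rw [mem_codeD]
    exact ⟨heven y hy, hf hy⟩
  refine ⟨s, wt_four s h0 h1 ?_ ?_, Submodule.eq_of_le_of_finrank_eq hCD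
    (by rw [hr, finrank_codeD s h0 h1])⟩
  · have := hf (hRM ⟨0, 1, rfl⟩)
    simpa [pairing_apply] using this
  · intro i
    have := hf (hRM ⟨Pi.single i 1, 0, rfl⟩)
    simpa [pairing_apply, Pi.single_apply] using this

lemma exists_perm (s t : (Fin 3 → ZMod 2) → ZMod 2) (h : wt s = wt t) :
    ∃ σ : Equiv.Perm (Fin 3 → ZMod 2), ∀ v, s (σ v) = t v := by
  have hc : Fintype.card {v // t v ≠ 0} = Fintype.card {v // s v ≠ 0} := by
    rw [Fintype.card_subtype, Fintype.card_subtype]; exact h.symm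
  let e := Fintype.equivOfCardEq hc
  refine ⟨e.extendSubtype, fun v => ?_⟩
  by_cases hv : t v = 0
  · have := e.extendSubtype_not_mem v (by simpa using hv)
    rw [hv]; simpa using this
  · have := e.extendSubtype_mem v hv
    rw [(z2 _).resolve_left hv, (z2 _).resolve_left this]

lemma equiv_code (s t : (Fin 3 → ZMod 2) → ZMod 2) (h : wt s = wt t) :
    CodeEquiv (codeD s : Set ((Fin 3 → ZMod 2) → ZMod 2)) (codeD t) := by
  obtain ⟨σ, hσ⟩ := exists_perm s t h
  have key : ∀ x, x ∘ σ ∈ codeD t ↔ x ∈ codeD s := by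
    intro x
    simp only [mem_codeD, Function.comp, ← hσ]
    rw [Equiv.sum_comp σ x, Equiv.sum_comp σ (fun v => s v * x v)]
  refine ⟨σ, ?_⟩
  ext y
  constructor
  · intro hy
    refine ⟨y ∘ σ.symm, ?_, ?_⟩
    · rw [SetLike.mem_coe, ← key]
      simpa [Function.comp_assoc] using hy
    · simp [Function.comp_assoc]
  · rintro ⟨x, hx, rfl⟩
    exact (key x).2 hx

lemma exists_code : SatCond 3 6 2 (codeD fun v => v 0) := by
  refine ⟨finrank_codeD _ ?_ ?_, by norm_num, by norm_num, ?_, ?_⟩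
  · exact fun h => absurd (congrFun h 1) (by decide)
  · exact fun h => absurd (congrFun h 0) (by decide)
  · ext w
    simp only [Set.mem_setOf_eq, Set.mem_insert_iff, Set.mem_singleton_iff]
    constructor
    · rintro ⟨x, hx, rfl⟩
      have h1 := ((mem_codeD _ _).1 hx).1
      rw [sum_eq_wt, ZMod.natCast_eq_zero_iff] at h1
      have h2 : wt x ≤ 8 := (Finset.card_filter_le _ _).trans (by decide)
      norm_num
      omega
    · rintro (rfl | rfl | rfl | rfl | rfl)
      · exact ⟨0, by rw [mem_codeD]; decide, by decide⟩
      · exact ⟨fun v => v 0 * v 1, by rw [mem_codeD]; decide, by decide⟩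
      · exact ⟨fun v => v 1, by rw [mem_codeD]; decide, by decide⟩
      · exact ⟨fun v => 1 + v 0 * v 1, by rw [mem_codeD]; decide, by decide⟩
      · exact ⟨1, by rw [mem_codeD]; decide, by decide⟩
  · rintro _ ⟨a, b, rfl⟩
    rw [SetLike.mem_coe, mem_codeD]
    simp only [sum_cube, Fin.sum_univ_three, Matrix.cons_val]
    generalize a 0 = p
    generalize a 1 = q
    generalize a 2 = r
    revert p q r b
    decide

/-- there is a binary `[8,6]` code satisfying (C1) and (C2), any
two such codes are equivalent, and the set of weights of any such code is
exactly `{0, 2, 4, 6, 8}` (i.e. `a = 2`). -/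
theorem stmt8 :
    (∃ (C : Submodule (ZMod 2) ((Fin 3 → ZMod 2) → ZMod 2)) (a : ℕ), SatCond 3 6 a C) ∧
    (∀ (C C' : Submodule (ZMod 2) ((Fin 3 → ZMod 2) → ZMod 2)) (a a' : ℕ),
      SatCond 3 6 a C → SatCond 3 6 a' C' →
      CodeEquiv (↑C : Set ((Fin 3 → ZMod 2) → ZMod 2)) (↑C')) ∧
    (∀ (C : Submodule (ZMod 2) ((Fin 3 → ZMod 2) → ZMod 2)) (a : ℕ),
      SatCond 3 6 a C →
      {w : ℕ | ∃ x ∈ C, wt x = w} = ({0, 2, 4, 6, 8} : Set ℕ)) := by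
  refine ⟨⟨_, 2, exists_code⟩, ?_, fun C a h => weights h⟩
  intro C C' a a' h h'
  obtain ⟨s, hs, rfl⟩ := classify_code h
  obtain ⟨t, ht, rfl⟩ := classify_code h'
  exact equiv_code s t (hs.trans ht.symm)
end
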